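/- Let u : ℝ² → ℝ be a Lipschitz function that is positively homogeneous of degree 1 (that is, u(t·x) = t·u(x) for all t > 0 and all x ∈ ℝ²), smooth on ℝ² \ {0}, and satisfying the minimal surface equation on ℝ² \ {0}. Then u is linear: there exists a ∈ ℝ² such that u(x) = ⟨a, x⟩ for all x ∈ ℝ². Equivalently, a minimal cone in Euclidean ℝ³ that is a Lipschitz graph over ℝ² is a plane. -/

import Mathlib

open scoped RealInnerProductSpace

noncomputable section

/-- The partial derivative `∂ᵢ u` of a function `u : ℝ² → ℝ`. -/
noncomputable def pderiv2 (u : EuclideanSpace ℝ (Fin 2) → ℝ) (i : Fin 2)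
    (x : EuclideanSpace ℝ (Fin 2)) : ℝ :=
  fderiv ℝ u x (EuclideanSpace.single i 1)

/-- `u` satisfies the minimal surface equation on `U`: it is `C²` on `U` and
`(1 + (∂₂u)²)∂₁₁u − 2 ∂₁u ∂₂u ∂₁₂u + (1 + (∂₁u)²)∂₂₂u = 0` on `U`. -/
def MinimalSurfaceEquation (u : EuclideanSpace ℝ (Fin 2) → ℝ)
    (U : Set (EuclideanSpace ℝ (Fin 2))) : Prop :=
  ContDiffOn ℝ 2 u U ∧ ∀ x ∈ U,
    (1 + (pderiv2 u 1 x) ^ 2) * pderiv2 (pderiv2 u 0) 0 x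
      - 2 * pderiv2 u 0 x * pderiv2 u 1 x * pderiv2 (pderiv2 u 1) 0 x
      + (1 + (pderiv2 u 0 x) ^ 2) * pderiv2 (pderiv2 u 1) 1 x = 0

/-- The derivative of a positively `1`-homogeneous function is positively `0`-homogeneous. -/
theorem fderiv_smul_of_posHomogeneous {E F : Type*} [NormedAddCommGroup E] [NormedSpace ℝ E]
    [NormedAddCommGroup F] [NormedSpace ℝ F] {u : E → F}
    (hhom : ∀ t : ℝ, 0 < t → ∀ x : E, u (t • x) = t • u x) {t : ℝ} (ht : 0 < t) (x : E) :
    fderiv ℝ u (t • x) = fderiv ℝ u x := by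
  have h : (fun y => u (t • y)) = t • u := funext fun y => hhom t ht y
  have h1 := fderiv_comp_smul (𝕜 := ℝ) (f := u) (x := x) t
  rw [h, fderiv_const_smul_field] at h1
  exact (smul_right_injective _ ht.ne' h1).symm

/-- **Euler's identity** for positively `1`-homogeneous functions. -/
theorem fderiv_apply_self_of_posHomogeneous {E F : Type*} [NormedAddCommGroup E]
    [NormedSpace ℝ E] [NormedAddCommGroup F] [NormedSpace ℝ F] {u : E → F}
    (hhom : ∀ t : ℝ, 0 < t → ∀ x : E, u (t • x) = t • u x) {x : E}
    (hu : DifferentiableAt ℝ u x) : fderiv ℝ u x x = u x := by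
  have hs : HasDerivAt (fun t : ℝ => t • x) x 1 := by
    simpa using (hasDerivAt_id (1 : ℝ)).smul_const x
  have h1 : HasDerivAt (fun t : ℝ => u (t • x)) (fderiv ℝ u x x) 1 :=
    HasFDerivAt.comp_hasDerivAt (1 : ℝ) (by simpa using hu.hasFDerivAt) hs
  have h2 : HasDerivAt (fun t : ℝ => t • u x) (u x) 1 := by
    simpa using (hasDerivAt_id (1 : ℝ)).smul_const (u x)
  refine h1.unique (h2.congr_of_eventuallyEq ?_)
  filter_upwards [lt_mem_nhds (zero_lt_one (α := ℝ))] with t ht using hhom t ht x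

/-- The derivative of a positively `0`-homogeneous function vanishes in the radial direction. -/
theorem fderiv_apply_self_of_smul_invariant {E F : Type*} [NormedAddCommGroup E]
    [NormedSpace ℝ E] [NormedAddCommGroup F] [NormedSpace ℝ F] {g : E → F} {x : E}
    (hg : ∀ t : ℝ, 0 < t → g (t • x) = g x) (hd : DifferentiableAt ℝ g x) :
    fderiv ℝ g x x = 0 := by
  have hs : HasDerivAt (fun t : ℝ => t • x) x 1 := by
    simpa using (hasDerivAt_id (1 : ℝ)).smul_const x
  have h1 : HasDerivAt (fun t : ℝ => g (t • x)) (fderiv ℝ g x x) 1 :=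
    HasFDerivAt.comp_hasDerivAt (1 : ℝ) (by simpa using hd.hasFDerivAt) hs
  refine h1.unique ((hasDerivAt_const (1 : ℝ) (g x)).congr_of_eventuallyEq ?_)
  filter_upwards [lt_mem_nhds (zero_lt_one (α := ℝ))] with t ht using hg t ht

/-- If `c ≠ 0`, a symmetric matrix `!![a, b; b, d]` with `(c, s)` in its kernel which satisfies the
minimal surface equation for the gradient `(p, q)` has `d = 0`. -/
theorem eq_zero_of_minimalSurface_of_kernel {a b d c s p q : ℝ} (hc : c ≠ 0)
    (h0 : c * a + s * b = 0) (h1 : c * b + s * d = 0)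
    (hm : (1 + q ^ 2) * a - 2 * p * q * b + (1 + p ^ 2) * d = 0) : a = 0 ∧ b = 0 ∧ d = 0 := by
  have hd : d * (c ^ 2 + s ^ 2 + (c * p + s * q) ^ 2) = 0 := by
    linear_combination c ^ 2 * hm - (1 + q ^ 2) * c * h0 + (1 + q ^ 2) * s * h1
      + 2 * p * q * c * h1
  have hd0 : d = 0 := (mul_eq_zero.1 hd).resolve_right (by positivity)
  subst hd0
  have hb : b = 0 := by simpa [hc] using h1
  subst hb
  exact ⟨by simpa [hc] using h0, rfl, rfl⟩

theorem pderiv2_pderiv2 {u : EuclideanSpace ℝ (Fin 2) → ℝ} {x : EuclideanSpace ℝ (Fin 2)}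
    (hd : DifferentiableAt ℝ (fderiv ℝ u) x) (i j : Fin 2) :
    pderiv2 (pderiv2 u i) j x = fderiv ℝ (fderiv ℝ u) x (EuclideanSpace.single j 1)
      (EuclideanSpace.single i 1) := by
  have h := hd.hasFDerivAt.clm_apply
    (hasFDerivAt_const (EuclideanSpace.single i (1 : ℝ)) x)
  rw [pderiv2, show pderiv2 u i = fun y => fderiv ℝ u y (EuclideanSpace.single i 1) from rfl,
    h.fderiv]
  simp

theorem EuclideanSpace.eq_smul_single_add_smul_single (x : EuclideanSpace ℝ (Fin 2)) :
    x = x 0 • EuclideanSpace.single 0 1 + x 1 • EuclideanSpace.single 1 1 := by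
  ext i
  fin_cases i <;> simp

/-- The Hessian of a positively `1`-homogeneous solution of the minimal surface equation on
`ℝ² \ {0}` vanishes. -/
theorem MinimalSurfaceEquation.fderiv_fderiv_eq_zero {u : EuclideanSpace ℝ (Fin 2) → ℝ}
    (hmse : MinimalSurfaceEquation u {(0 : EuclideanSpace ℝ (Fin 2))}ᶜ)
    (hhom : ∀ t : ℝ, 0 < t → ∀ x : EuclideanSpace ℝ (Fin 2), u (t • x) = t • u x)
    {x : EuclideanSpace ℝ (Fin 2)} (hx : x ≠ 0) : fderiv ℝ (fderiv ℝ u) x = 0 := by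
  have hC : ContDiffAt ℝ 2 u x := hmse.1.contDiffAt (isOpen_compl_singleton.mem_nhds hx)
  have hd : DifferentiableAt ℝ (fderiv ℝ u) x :=
    (hC.fderiv_right (m := 1) (by norm_num)).differentiableAt (by norm_num)
  have hsymm := hC.isSymmSndFDerivAt (by simp)
  have hker := fderiv_apply_self_of_smul_invariant
    (fun t ht => fderiv_smul_of_posHomogeneous hhom ht x) hd
  have hm := hmse.2 x hx
  simp only [pderiv2_pderiv2 hd] at hm
  set B := fderiv ℝ (fderiv ℝ u) x
  set e₀ : EuclideanSpace ℝ (Fin 2) := EuclideanSpace.single 0 1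
  set e₁ : EuclideanSpace ℝ (Fin 2) := EuclideanSpace.single 1 1
  have hs : B e₁ e₀ = B e₀ e₁ := hsymm e₁ e₀
  have hdec : ∀ y : EuclideanSpace ℝ (Fin 2), y = y 0 • e₀ + y 1 • e₁ :=
    EuclideanSpace.eq_smul_single_add_smul_single
  have hrow : ∀ w, x 0 * B e₀ w + x 1 * B e₁ w = 0 := fun w => by
    have h := congrArg (fun L => L w) hker
    rw [hdec x] at h
    simpa using h
  have h0 := hrow e₀
  have h1 := hrow e₁
  rw [hs] at h0
  have key : B e₀ e₀ = 0 ∧ B e₀ e₁ = 0 ∧ B e₁ e₁ = 0 := by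
    by_cases hc : x 0 = 0
    · have hc' : x 1 ≠ 0 := fun h => hx (by rw [hdec x, hc, h]; simp)
      obtain ⟨h11, h01, h00⟩ := eq_zero_of_minimalSurface_of_kernel (a := B e₁ e₁) (b := B e₀ e₁)
        (d := B e₀ e₀) (s := x 0) (p := pderiv2 u 1 x) (q := pderiv2 u 0 x) hc'
        (by linear_combination h1) (by linear_combination h0) (by linear_combination hm)
      exact ⟨h00, h01, h11⟩
    · exact eq_zero_of_minimalSurface_of_kernel hc h0 h1 hm
  obtain ⟨h00, h01, h11⟩ := key
  ext v w
  rw [hdec v, hdec w]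
  simp [h00, h01, h11, hs]

/-- A minimal cone in Euclidean `ℝ³` that is a Lipschitz graph over `ℝ²`
is a plane: a Lipschitz, positively `1`-homogeneous function that is smooth and satisfies the
minimal surface equation away from the origin is linear. -/
theorem minimal_cone_lipschitz_graph_is_plane
    (u : EuclideanSpace ℝ (Fin 2) → ℝ) (K : NNReal) (hlip : LipschitzWith K u)
    (hhom : ∀ t : ℝ, 0 < t → ∀ x : EuclideanSpace ℝ (Fin 2), u (t • x) = t * u x)
    (hsmooth : ContDiffOn ℝ (⊤ : ℕ∞) u {(0 : EuclideanSpace ℝ (Fin 2))}ᶜ)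
    (hmse : MinimalSurfaceEquation u {(0 : EuclideanSpace ℝ (Fin 2))}ᶜ) :
    ∃ a : EuclideanSpace ℝ (Fin 2), ∀ x : EuclideanSpace ℝ (Fin 2), u x = ⟪a, x⟫ := by
  have hhom' : ∀ t : ℝ, 0 < t → ∀ x : EuclideanSpace ℝ (Fin 2), u (t • x) = t • u x := hhom
  have hrank : 1 < Module.rank ℝ (EuclideanSpace ℝ (Fin 2)) := by
    rw [← Module.finrank_eq_rank]
    simp
  have hC := fun x (hx : x ≠ (0 : EuclideanSpace ℝ (Fin 2))) =>
    hmse.1.contDiffAt (isOpen_compl_singleton.mem_nhds hx)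
  obtain ⟨L, hL⟩ := isOpen_compl_singleton.exists_is_const_of_fderiv_eq_zero (𝕜 := ℝ)
    (isConnected_compl_singleton_of_one_lt_rank hrank
      (0 : EuclideanSpace ℝ (Fin 2))).isPreconnected
    (f := fderiv ℝ u)
    (fun x hx => (((hC x hx).fderiv_right (m := 1) (by norm_num)).differentiableAt
      (by norm_num)).differentiableWithinAt)
    (fun x hx => hmse.fderiv_fderiv_eq_zero hhom' hx)
  refine ⟨(InnerProductSpace.toDual ℝ _).symm L, fun x => ?_⟩
  rw [InnerProductSpace.toDual_symm_apply]
  by_cases hx : x = 0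
  · subst hx
    have h := hhom 2 two_pos 0
    rw [smul_zero] at h
    rw [map_zero]
    linarith
  · rw [← hL x hx, fderiv_apply_self_of_posHomogeneous hhom'
      ((hC x hx).differentiableAt (by norm_num))]
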